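/- arXiv:cs/0412061 — 4 statements merged into one kernel-verified Lean document; each statement's English description precedes it below -/
import Mathlib

section
/- Let R be a commutative ring, ι a finite type, α and β finite types, σ ∈ Perm α, τ ∈ Perm β. Then 𝔷(Equiv.prodCongr σ τ) = ∏_{p=1}^{|α|} ∏_{q=1}^{|β|} (p_{lcm(p,q)})^{gcd(p,q) · c_p(σ) · c_q(τ)} in MvPolynomial ι R. (This expresses that the cycle-index map sends the Cartesian product of permutations to the ⋆-product of symmetric functions, defined on power sums by ψ_p ⋆ ψ_q = ψ_{lcm(p,q)}^{gcd(p,q)}.) -/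
/-- `cycCount π j` is the number of orbits of cardinality `j` of the cyclic subgroup
generated by `π` acting on `γ` (fixed points count as orbits of size `1`). -/
noncomputable def cycCount {γ : Type*} [Fintype γ] (π : Equiv.Perm γ) (j : ℕ) : ℕ :=
  Nat.card {ω : MulAction.orbitRel.Quotient (Subgroup.zpowers π) γ // Nat.card ω.orbit = j}

/-- The cycle-index map `𝔷(π) = ∏_{j ≥ 1} (p_j)^{c_j(π)}`, where `p_j` is the `j`-th
power-sum symmetric polynomial. -/
noncomputable def cycleIndex (ι R : Type*) [Fintype ι] [CommRing R]
    {γ : Type*} [Fintype γ] (π : Equiv.Perm γ) : MvPolynomial ι R :=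
  ∏ j ∈ Finset.Icc 1 (Fintype.card γ), (MvPolynomial.psum ι R j) ^ (cycCount π j)

open Function Finset in
/-- Each cycle of length `j` consists of `j` points of minimal period `j`. -/
theorem cycCount_mul_self {γ : Type*} [Fintype γ] (π : Equiv.Perm γ) (j : ℕ) :
    cycCount π j * j = #{x : γ | minimalPeriod π x = j} := by
  classical
  let mk : γ → MulAction.orbitRel.Quotient (Subgroup.zpowers π) γ := Quotient.mk''
  have card_orbit (x : γ) : Nat.card (mk x).orbit = minimalPeriod π x := by
    rw [MulAction.orbitRel.Quotient.orbit_mk, Nat.card_eq_fintype_card,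
      ← MulAction.minimalPeriod_eq_card]
    rfl
  rw [cycCount, Nat.card_eq_fintype_card, Fintype.card_subtype,
    card_eq_sum_card_fiberwise (f := mk) (t := {ω | Nat.card ω.orbit = j})
      (fun x hx ↦ mem_filter.2 ⟨mem_univ _, (card_orbit x).trans (mem_filter.1 hx).2⟩)]
  refine (sum_const_nat fun ω hω ↦ ?_).symm
  rw [mem_filter_univ] at hω
  rw [← hω, Nat.card_eq_fintype_card, ← Set.toFinset_card]
  congr 1
  ext x
  rw [mem_filter, mem_filter_univ, Set.mem_toFinset, MulAction.orbitRel.Quotient.mem_orbit]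
  refine ⟨And.right, fun hx ↦ ⟨?_, hx⟩⟩
  rw [← card_orbit, show mk x = ω from hx, Nat.card_eq_fintype_card, Set.toFinset_card]

open Function in
theorem minimalPeriod_perm_mem_Icc {γ : Type*} [Fintype γ] (π : Equiv.Perm γ) (x : γ) :
    minimalPeriod π x ∈ Finset.Icc 1 (Fintype.card γ) :=
  Finset.mem_Icc.2 ⟨minimalPeriod_pos_of_mem_periodicPts
    (π.injective.mem_periodicPts x), minimalPeriod_le_card⟩

open Function Finset in
/-- A `p`-cycle times a `q`-cycle decomposes into `gcd p q` cycles of length `lcm p q`. -/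
theorem cycCount_prodCongr {α β : Type*} [Fintype α] [Fintype β] (σ : Equiv.Perm α)
    (τ : Equiv.Perm β) {j : ℕ} (hj : 0 < j) :
    cycCount (Equiv.prodCongr σ τ) j =
      ∑ pq ∈ Icc 1 (Fintype.card α) ×ˢ Icc 1 (Fintype.card β) with Nat.lcm pq.1 pq.2 = j,
        Nat.gcd pq.1 pq.2 * cycCount σ pq.1 * cycCount τ pq.2 := by
  have period (z : α × β) : minimalPeriod (Equiv.prodCongr σ τ) z =
      Nat.lcm (minimalPeriod σ z.1) (minimalPeriod τ z.2) := minimalPeriod_prodMap σ τ z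
  refine Nat.eq_of_mul_eq_mul_right hj ?_
  rw [cycCount_mul_self, sum_mul, card_eq_sum_card_fiberwise
    (f := fun z : α × β ↦ (minimalPeriod σ z.1, minimalPeriod τ z.2))
    (t := {pq ∈ Icc 1 (Fintype.card α) ×ˢ Icc 1 (Fintype.card β) | Nat.lcm pq.1 pq.2 = j})
    fun z hz ↦ mem_filter.2
      ⟨mem_product.2 ⟨minimalPeriod_perm_mem_Icc σ z.1, minimalPeriod_perm_mem_Icc τ z.2⟩,
        (period z).symm.trans (mem_filter_univ z |>.1 hz)⟩]
  refine sum_congr rfl fun ⟨p, q⟩ hpq ↦ ?_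
  obtain rfl := (mem_filter.1 hpq).2
  have fiber : ({z ∈ ({z | minimalPeriod (Equiv.prodCongr σ τ) z = Nat.lcm p q} : Finset (α × β)) |
      (minimalPeriod σ z.1, minimalPeriod τ z.2) = (p, q)}) =
      ({x | minimalPeriod σ x = p} : Finset α) ×ˢ ({y | minimalPeriod τ y = q} : Finset β) := by
    ext z
    simp only [mem_filter, mem_univ, true_and, mem_product, Prod.mk.injEq, period,
      and_iff_right_iff_imp]
    rintro ⟨rfl, rfl⟩
    rfl
  rw [fiber, card_product, ← cycCount_mul_self, ← cycCount_mul_self]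
  calc cycCount σ p * p * (cycCount τ q * q)
      = cycCount σ p * cycCount τ q * (p * q) := by ring
    _ = Nat.gcd p q * cycCount σ p * cycCount τ q * Nat.lcm p q := by
      rw [← Nat.gcd_mul_lcm p q]; ring

/-- The cycle-index map sends the Cartesian product of permutations to the `⋆`-product
of symmetric functions (defined on power sums by `ψ_p ⋆ ψ_q = ψ_{lcm(p,q)}^{gcd(p,q)}`):
`𝔷(σ × τ) = ∏_p ∏_q (p_{lcm(p,q)})^{gcd(p,q)·c_p(σ)·c_q(τ)}`. -/
theorem cycleIndex_prodCongr (R : Type*) [CommRing R] (ι : Type*) [Fintype ι]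
    {α β : Type*} [Fintype α] [Fintype β] (σ : Equiv.Perm α) (τ : Equiv.Perm β) :
    cycleIndex ι R (Equiv.prodCongr σ τ)
      = ∏ p ∈ Finset.Icc 1 (Fintype.card α), ∏ q ∈ Finset.Icc 1 (Fintype.card β),
          (MvPolynomial.psum ι R (Nat.lcm p q)) ^ (Nat.gcd p q * cycCount σ p * cycCount τ q) := by
  rw [← Finset.prod_product', ← Finset.prod_fiberwise_of_maps_to
    (t := Finset.Icc 1 (Fintype.card (α × β))) (g := fun pq : ℕ × ℕ ↦ Nat.lcm pq.1 pq.2)]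
  · refine Finset.prod_congr rfl fun j hj ↦ ?_
    rw [cycCount_prodCongr σ τ (Finset.mem_Icc.1 hj).1, ← Finset.prod_pow_eq_pow_sum]
    exact Finset.prod_congr rfl fun pq hpq ↦ by rw [(Finset.mem_filter.1 hpq).2]
  · intro pq hpq
    simp only [Finset.mem_product, Finset.mem_Icc] at hpq
    rw [Finset.mem_Icc, Fintype.card_prod]
    exact ⟨Nat.lcm_pos hpq.1.1 hpq.2.1, (Nat.lcm_le_mul hpq.1.1 hpq.2.1).trans
      (Nat.mul_le_mul hpq.1.2 hpq.2.2)⟩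
end

section
/- Cycle index of the alternating group: for every commutative ring R, finite type ι, and n ≥ 2, 2 • Σ_{σ ∈ alternatingGroup (Fin n)} 𝔷(σ) = n! • (h_n + e_n) in MvPolynomial ι R, where h_n is the complete homogeneous symmetric polynomial of degree n and e_n = MvPolynomial.esymm ι n is the elementary symmetric polynomial of degree n. Equivalently, over ℚ the cycle index polynomial Z(A_n) equals h_n + e_n. -/
open MvPolynomial Finset Equiv

theorem cycleIndex_eq_prod_orbits (ι R : Type*) [Fintype ι] [CommRing R] {γ : Type*} [Fintype γ]
    (π : Perm γ) [Fintype (MulAction.orbitRel.Quotient (Subgroup.zpowers π) γ)] :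
    cycleIndex ι R π = ∏ ω : MulAction.orbitRel.Quotient (Subgroup.zpowers π) γ,
      psum ι R (Nat.card ω.orbit) := by
  classical
  have hmem : ∀ ω ∈ (univ : Finset (MulAction.orbitRel.Quotient (Subgroup.zpowers π) γ)),
      Nat.card ω.orbit ∈ Icc 1 (Fintype.card γ) := by
    intro ω _
    have : Nonempty ω.orbit := (MulAction.orbitRel.Quotient.nonempty_orbit ω).to_subtype
    rw [mem_Icc, ← Nat.card_eq_fintype_card]
    exact ⟨Nat.card_pos, Finite.card_subtype_le _⟩
  rw [cycleIndex, ← prod_fiberwise_of_maps_to hmem]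
  refine prod_congr rfl fun j _ => ?_
  rw [prod_congr rfl fun ω hω => by rw [(mem_filter.mp hω).2], prod_const, cycCount,
    Nat.card_eq_fintype_card, Fintype.card_subtype]

theorem cycleIndex_eq_sum_invariant (ι R : Type*) [Fintype ι] [DecidableEq ι] [CommRing R]
    {γ : Type*} [Fintype γ] [DecidableEq γ] (π : Perm γ) :
    cycleIndex ι R π = ∑ f : γ → ι with f ∘ π = f, ∏ x, (X (f x) : MvPolynomial ι R) := by
  classical
  let Ω := MulAction.orbitRel.Quotient (Subgroup.zpowers π) γ
  let q : γ → Ω := Quotient.mk''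
  have hq : Function.Surjective q := Quotient.mk''_surjective
  have : Fintype Ω := Fintype.ofFinite Ω
  rw [cycleIndex_eq_prod_orbits]
  simp only [psum]
  rw [Fintype.prod_sum]
  refine sum_bij (fun F _ => F ∘ q) ?_ ?_ ?_ ?_
  · intro F _
    rw [mem_filter]
    refine ⟨mem_univ _, funext fun x => congrArg F (Quotient.sound' ?_)⟩
    exact ⟨⟨π, Subgroup.mem_zpowers π⟩, rfl⟩
  · exact fun F _ G _ h => hq.injective_comp_right h
  · intro f hf
    have hinv : ∀ g : Subgroup.zpowers π, ∀ x, f (g • x) = f x := by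
      rintro ⟨g, hg⟩ x
      obtain ⟨k, rfl⟩ := mem_powers_iff_mem_zpowers.mpr hg
      induction k with
      | zero => rfl
      | succ k ih =>
        have hk : π ^ k ∈ Subgroup.zpowers π := Subgroup.npow_mem_zpowers π k
        calc f ((π ^ (k + 1)) x) = f (π ((π ^ k) x)) := by rw [pow_succ', Perm.mul_apply]
          _ = f ((π ^ k) x) := congrFun (mem_filter.mp hf).2 _
          _ = f x := ih hk
    refine ⟨fun ω => Quotient.liftOn' ω f ?_, mem_univ _, rfl⟩
    rintro x y ⟨g, rfl⟩
    exact hinv g y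
  · intro F _
    have hcard : ∀ ω : Ω, Nat.card ω.orbit = #{x | q x = ω} := by
      intro ω
      rw [← Fintype.card_subtype, ← Nat.card_eq_fintype_card]
      exact Nat.card_congr (Equiv.subtypeEquivRight fun x => MulAction.orbitRel.Quotient.mem_orbit)
    rw [← Finset.prod_fiberwise univ q]
    refine prod_congr rfl fun ω _ => ?_
    rw [hcard, ← prod_const]
    exact prod_congr rfl fun x hx => by rw [← (mem_filter.mp hx).2]; rfl

theorem exists_perm_comp_eq_of_map_univ_eq {α γ : Type*} [Fintype γ] {f g : γ → α}
    (h : univ.val.map f = univ.val.map g) : ∃ τ : Perm γ, g ∘ τ = f := by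
  classical
  have hcard : ∀ a, Nonempty ({x // f x = a} ≃ {x // g x = a}) := by
    intro a
    have := congrArg (Multiset.count a) h
    simp only [Multiset.count_map] at this
    rw [← Fintype.card_eq, Fintype.card_subtype, Fintype.card_subtype]
    simpa only [eq_comm, Finset.card, Finset.filter] using this
  let e := fun a => (hcard a).some
  exact ⟨Equiv.ofFiberEquiv e, funext fun x => Equiv.ofFiberEquiv_map e x⟩

theorem exists_map_univ_eq {α : Type*} {n : ℕ} {s : Multiset α} (hs : s.card = n) :
    ∃ f : Fin n → α, univ.val.map f = s := by
  subst hs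
  induction s using Quotient.inductionOn with
  | h l =>
    refine ⟨l.get, (Fin.univ_val_map l.get).trans ?_⟩
    rw [List.ofFn_get]
    rfl

theorem sum_card_filter_comp_perm_eq {α γ : Type*} [Fintype α] [DecidableEq α] [Fintype γ]
    [DecidableEq γ] (f₀ : γ → α) :
    ∑ f : γ → α with univ.val.map f = univ.val.map f₀, #{σ : Perm γ | f ∘ σ = f}
      = (Fintype.card γ).factorial := by
  rw [← Fintype.card_perm, ← card_univ,
    card_eq_sum_card_fiberwise (f := fun σ : Perm γ => f₀ ∘ σ)
      (t := {f : γ → α | univ.val.map f = univ.val.map f₀})]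
  · refine sum_congr rfl fun f hf => ?_
    obtain ⟨τ, rfl⟩ := exists_perm_comp_eq_of_map_univ_eq (mem_filter.mp hf).2
    refine card_equiv (Equiv.mulLeft τ) fun σ => ?_
    simp [Function.comp_assoc]
  · intro σ _
    rw [mem_coe, mem_filter, ← Multiset.map_map, Multiset.map_univ_val_equiv]
    exact ⟨mem_univ _, rfl⟩

theorem sum_perm_sum_invariant_prod_X (ι R : Type*) [Fintype ι] [DecidableEq ι] [CommRing R]
    (n : ℕ) :
    ∑ σ : Perm (Fin n), ∑ f : Fin n → ι with f ∘ σ = f, ∏ x, (X (f x) : MvPolynomial ι R)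
      = n.factorial • hsymm ι R n := by
  simp only [sum_filter]
  rw [sum_comm, hsymm, smul_sum,
    ← sum_fiberwise univ fun f : Fin n → ι => Sym.mk (n := n) (univ.val.map f) (by simp)]
  refine sum_congr rfl fun s _ => ?_
  obtain ⟨f₀, hf₀⟩ := exists_map_univ_eq s.2
  have hcard := sum_card_filter_comp_perm_eq f₀
  rw [Fintype.card_fin] at hcard
  rw [← hcard, sum_smul]
  refine sum_congr (filter_congr fun f _ => ?_) fun f hf => ?_
  · rw [hf₀, ← Sym.coe_inj]
    rfl
  · rw [← sum_filter, sum_const, ← hf₀, ← (mem_filter.mp hf).2, Multiset.map_map]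
    rfl

theorem filter_comp_perm_eq_of_injective {α γ : Type*} [DecidableEq α] [Fintype γ]
    [DecidableEq γ] {f : γ → α} (hf : Function.Injective f) :
    ({σ : Perm γ | f ∘ σ = f} : Finset (Perm γ)) = {1} := by
  ext σ
  simp only [mem_filter, mem_univ, true_and, mem_singleton]
  refine ⟨fun h => Equiv.ext fun x => hf (congrFun h x), ?_⟩
  rintro rfl
  rfl

theorem sum_sign_filter_comp_perm_eq {α γ : Type*} [DecidableEq α] [Fintype γ]
    [DecidableEq γ] (f : γ → α) [Decidable (Function.Injective f)] :
    ∑ σ ∈ ({σ | f ∘ σ = f} : Finset (Perm γ)), (Perm.sign σ : ℤ)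
      = if Function.Injective f then 1 else 0 := by
  split_ifs with hf
  · simp [filter_comp_perm_eq_of_injective hf]
  · obtain ⟨a, b, hab, hne⟩ := Function.not_injective_iff.mp hf
    have hswap : f ∘ swap a b = f := by
      rw [comp_swap_eq_update, hab, Function.update_eq_self, ← hab, Function.update_eq_self]
    refine sum_involution (fun σ _ => swap a b * σ) ?_ ?_ ?_ ?_
    · intro σ _
      simp [Perm.sign_mul, Perm.sign_swap hne]
    · intro σ _ _ h
      exact hne (swap_eq_one_iff.mp (mul_eq_right.mp h))
    · intro σ hσ
      simp only [mem_filter, mem_univ, true_and] at hσ ⊢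
      rw [Perm.coe_mul, ← Function.comp_assoc, hswap, hσ]
    · intro σ _
      simp

theorem sum_injective_prod_X (ι R : Type*) [Fintype ι] [DecidableEq ι] [CommRing R] (n : ℕ) :
    ∑ f : Fin n → ι with Function.Injective f, ∏ x, (X (f x) : MvPolynomial ι R)
      = n.factorial • esymm ι R n := by
  have hmem : ∀ f ∈ ({f | Function.Injective f} : Finset (Fin n → ι)),
      univ.image f ∈ powersetCard n univ := by
    intro f hf
    rw [mem_powersetCard, card_image_of_injective _ (mem_filter.mp hf).2]
    simp
  rw [← sum_fiberwise_of_maps_to hmem, esymm, smul_sum]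
  refine sum_congr rfl fun t ht => ?_
  obtain ⟨f₀, hf₀⟩ := exists_map_univ_eq (mem_powersetCard.mp ht).2
  have hiff : ∀ f : Fin n → ι,
      Function.Injective f ∧ univ.image f = t ↔ univ.val.map f = univ.val.map f₀ := by
    intro f
    rw [hf₀]
    constructor
    · rintro ⟨hf, rfl⟩
      rw [image_val_of_injOn hf.injOn]
    · intro h
      refine ⟨fun x y hxy => Multiset.inj_on_of_nodup_map (h ▸ t.nodup) x (mem_univ x) y
        (mem_univ y) hxy, ?_⟩
      rw [Finset.image, h]
      exact t.val_toFinset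
  rw [filter_filter, filter_congr fun f _ => hiff f]
  have hcard := sum_card_filter_comp_perm_eq f₀
  rw [Fintype.card_fin] at hcard
  rw [← hcard, sum_smul]
  refine sum_congr rfl fun f hf => ?_
  have hf' := (mem_filter.mp hf).2
  rw [filter_comp_perm_eq_of_injective ((hiff f).mpr hf').1, card_singleton, one_smul,
    prod_eq_multiset_prod, prod_eq_multiset_prod, ← hf₀, ← hf', Multiset.map_map]
  rfl

theorem sum_perm_sign_smul_sum_invariant_prod_X (ι R : Type*) [Fintype ι] [DecidableEq ι]
    [CommRing R] (n : ℕ) :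
    ∑ σ : Perm (Fin n), (Perm.sign σ : ℤ) •
        ∑ f : Fin n → ι with f ∘ σ = f, ∏ x, (X (f x) : MvPolynomial ι R)
      = n.factorial • esymm ι R n := by
  rw [← sum_injective_prod_X, sum_filter]
  simp only [smul_sum, sum_filter, smul_ite, smul_zero]
  rw [sum_comm]
  refine sum_congr rfl fun f _ => ?_
  rw [← sum_filter, ← sum_smul, sum_sign_filter_comp_perm_eq, ite_smul, one_smul, zero_smul]

theorem two_nsmul_sum_alternatingGroup {γ M : Type*} [Fintype γ] [DecidableEq γ]
    [AddCommGroup M] (z : Perm γ → M) :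
    2 • ∑ σ : alternatingGroup γ, z σ = ∑ σ, z σ + ∑ σ : Perm γ, (Perm.sign σ : ℤ) • z σ := by
  rw [← sum_add_distrib, ← sum_subtype {σ : Perm γ | Perm.sign σ = 1}
    (by simp [Perm.mem_alternatingGroup]), sum_filter, smul_sum]
  refine sum_congr rfl fun σ _ => ?_
  rcases Int.units_eq_one_or (Perm.sign σ) with h | h <;> simp [h, two_nsmul]

/-- Cycle index of the alternating group: `2 • Σ_{σ ∈ A_n} 𝔷(σ) = n! • (h_n + e_n)`,
i.e. over `ℚ` the cycle index polynomial `Z(A_n)` equals `h_n + e_n`. -/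
theorem cycleIndex_alternatingGroup (R : Type*) [CommRing R] (ι : Type*) [Fintype ι]
    [DecidableEq ι] (n : ℕ) (hn : 2 ≤ n) :
    2 • ∑ σ : alternatingGroup (Fin n), cycleIndex ι R (σ : Equiv.Perm (Fin n))
      = (Nat.factorial n) • (MvPolynomial.hsymm ι R n + MvPolynomial.esymm ι R n) := by
  rw [two_nsmul_sum_alternatingGroup, smul_add, ← sum_perm_sum_invariant_prod_X,
    ← sum_perm_sign_smul_sum_invariant_prod_X]
  simp only [cycleIndex_eq_sum_invariant]
end

section
/- Decomposition of weighted bipartite graphs into their packed core (type-refined version): fix q ≥ 1, n, m ∈ ℕ, and a type function t : Fin q → ℕ with Σ_v t(v) = n·m and t(0) < n·m. Consider the action of Perm (Fin n) × Perm (Fin m) on matrices A : Fin n → Fin m → Fin q given by ((σ,τ)·A) i j = A (σ⁻¹ i) (τ⁻¹ j); the type of A is the function v ↦ #{(i,j) : A i j = v}, which is constant on orbits. Then the number of orbits of matrices of type t equals Σ_{k=1}^{n} Σ_{p=1}^{m} N(k,p,t), where N(k,p,t) is the number of orbits of the analogous action of Perm (Fin k) × Perm (Fin p) on packed matrices B :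 Fin k → Fin p → Fin q whose type t' satisfies t'(v) = t(v) for all v ≠ 0 and t'(0) = t(0) − (n·m − k·p) (and N(k,p,t) = 0 when t(0) < n·m − k·p). -/
/-- The action of `Perm (Fin n) × Perm (Fin m)` on matrices `A : Fin n → Fin m → Fin q`
(weighted bipartite graphs) given by `((σ,τ)·A) i j = A (σ⁻¹ i) (τ⁻¹ j)`. -/
instance matrixAction (n m q : ℕ) :
    MulAction (Equiv.Perm (Fin n) × Equiv.Perm (Fin m)) (Fin n → Fin m → Fin q) where
  smul g A := fun i j => A (g.1⁻¹ i) (g.2⁻¹ j)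
  one_smul A := by
    funext i j
    show A ((1 : Equiv.Perm (Fin n))⁻¹ i) ((1 : Equiv.Perm (Fin m))⁻¹ j) = A i j
    simp
  mul_smul g h A := by
    funext i j
    show A ((g.1 * h.1)⁻¹ i) ((g.2 * h.2)⁻¹ j) = A (h.1⁻¹ (g.1⁻¹ i)) (h.2⁻¹ (g.2⁻¹ j))
    simp [mul_inv_rev, Equiv.Perm.mul_apply]

/-- A matrix is packed if every row and every column contains a nonzero entry
(no isolated vertex in the corresponding bipartite graph). -/
def Packed {k p q : ℕ} [NeZero q] (B : Fin k → Fin p → Fin q) : Prop :=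
  (∀ i, ∃ j, B i j ≠ 0) ∧ ∀ j, ∃ i, B i j ≠ 0

/-- The induced action of `Perm (Fin k) × Perm (Fin p)` on the set of packed matrices. -/
instance packedMatrixAction (k p q : ℕ) [NeZero q] :
    MulAction (Equiv.Perm (Fin k) × Equiv.Perm (Fin p))
      {B : Fin k → Fin p → Fin q // Packed B} where
  smul g B := ⟨fun i j => B.val (g.1⁻¹ i) (g.2⁻¹ j), by
    obtain ⟨h1, h2⟩ := B.property
    constructor
    · intro i
      obtain ⟨j, hj⟩ := h1 (g.1⁻¹ i)
      exact ⟨g.2 j, by simpa using hj⟩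
    · intro j
      obtain ⟨i, hi⟩ := h2 (g.2⁻¹ j)
      exact ⟨g.1 i, by simpa using hi⟩⟩
  one_smul B := Subtype.ext <| by
    funext i j
    show B.val ((1 : Equiv.Perm (Fin k))⁻¹ i) ((1 : Equiv.Perm (Fin p))⁻¹ j) = B.val i j
    simp
  mul_smul g h B := Subtype.ext <| by
    funext i j
    show B.val ((g.1 * h.1)⁻¹ i) ((g.2 * h.2)⁻¹ j)
      = B.val (h.1⁻¹ (g.1⁻¹ i)) (h.2⁻¹ (g.2⁻¹ j))
    simp [mul_inv_rev, Equiv.Perm.mul_apply]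

/-- The type of a matrix `A` : the function sending each value `v` to the number of
entries `(i,j)` with `A i j = v`. It is constant on orbits of the action above. -/
def matType {n m q : ℕ} (A : Fin n → Fin m → Fin q) : Fin q → ℕ :=
  fun v => (Finset.univ.filter fun ij : Fin n × Fin m => A ij.1 ij.2 = v).card

/-- `B` is a core of `A`: it is the restriction of `A` to a set of rows and a set of columns
(listed in some order) outside of which `A` vanishes. -/
def IsCore {n m k p q : ℕ} [NeZero q] (A : Fin n → Fin m → Fin q)
    (B : Fin k → Fin p → Fin q) : Prop :=
  ∃ (e : Fin k ↪ Fin n) (f : Fin p ↪ Fin m), (∀ i j, A (e i) (f j) = B i j) ∧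
    ∀ i j, A i j ≠ 0 → i ∈ Set.range e ∧ j ∈ Set.range f

theorem exists_isCore_of_le {n m k p q : ℕ} [NeZero q] (hk : k ≤ n) (hp : p ≤ m)
    (B : Fin k → Fin p → Fin q) : ∃ A : Fin n → Fin m → Fin q, IsCore A B := by
  refine ⟨fun i j => if h : i.1 < k ∧ j.1 < p then B ⟨i, h.1⟩ ⟨j, h.2⟩ else 0,
    Fin.castLEEmb hk, Fin.castLEEmb hp, fun i j => by simp, fun i j h => ?_⟩
  by_cases hij : i.1 < k ∧ j.1 < p
  · exact ⟨⟨⟨i, hij.1⟩, rfl⟩, ⟨⟨j, hij.2⟩, rfl⟩⟩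
  · simp [hij] at h

theorem exists_packed_isCore {n m q : ℕ} [NeZero q] (A : Fin n → Fin m → Fin q) :
    ∃ (k p : ℕ) (B : Fin k → Fin p → Fin q), k ≤ n ∧ p ≤ m ∧ Packed B ∧ IsCore A B := by
  let R : Finset (Fin n) := Finset.univ.filter fun i => ∃ j, A i j ≠ 0
  let C : Finset (Fin m) := Finset.univ.filter fun j => ∃ i, A i j ≠ 0
  let e := (R.orderEmbOfFin rfl).toEmbedding
  let f := (C.orderEmbOfFin rfl).toEmbedding
  have he : ∀ i, i ∈ Set.range e ↔ ∃ j, A i j ≠ 0 := fun i => by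
    have h : Set.range e = (R : Set (Fin n)) := Finset.range_orderEmbOfFin R rfl
    simp [h, R]
  have hf : ∀ j, j ∈ Set.range f ↔ ∃ i, A i j ≠ 0 := fun j => by
    have h : Set.range f = (C : Set (Fin m)) := Finset.range_orderEmbOfFin C rfl
    simp [h, C]
  refine ⟨R.card, C.card, fun i j => A (e i) (f j), by simpa using R.card_le_univ,
    by simpa using C.card_le_univ, ⟨fun i => ?_, fun j => ?_⟩, e, f, fun _ _ => rfl,
    fun i j h => ⟨(he i).2 ⟨j, h⟩, (hf j).2 ⟨i, h⟩⟩⟩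
  · obtain ⟨j, hj⟩ := (he (e i)).1 ⟨i, rfl⟩
    obtain ⟨j, rfl⟩ := (hf j).2 ⟨_, hj⟩
    exact ⟨j, hj⟩
  · obtain ⟨i, hi⟩ := (hf (f j)).1 ⟨j, rfl⟩
    obtain ⟨i, rfl⟩ := (he i).2 ⟨_, hi⟩
    exact ⟨i, hi⟩

theorem exists_equiv_comp_eq {α β γ : Type*} {e : α ↪ γ} {e' : β ↪ γ}
    (h : Set.range e = Set.range e') : ∃ σ : α ≃ β, ∀ i, e' (σ i) = e i := by
  refine ⟨(Equiv.ofInjective e e.injective).trans ((Equiv.setCongr h).trans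
    (Equiv.ofInjective e' e'.injective).symm), fun i => ?_⟩
  simp [Equiv.apply_ofInjective_symm]

theorem IsCore.exists_equiv {n m k p k' p' q : ℕ} [NeZero q] {A : Fin n → Fin m → Fin q}
    {B : Fin k → Fin p → Fin q} {B' : Fin k' → Fin p' → Fin q} (h : IsCore A B)
    (h' : IsCore A B') (hB : Packed B) (hB' : Packed B') :
    ∃ (σ : Fin k ≃ Fin k') (τ : Fin p ≃ Fin p'), ∀ i j, B' (σ i) (τ j) = B i j := by
  obtain ⟨e, f, hef, hA⟩ := h
  obtain ⟨e', f', hef', hA'⟩ := h'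
  have he : Set.range e = Set.range e' := by
    apply Set.Subset.antisymm
    · rintro _ ⟨i, rfl⟩
      obtain ⟨j, hj⟩ := hB.1 i
      exact (hA' _ (f j) (by rwa [hef])).1
    · rintro _ ⟨i, rfl⟩
      obtain ⟨j, hj⟩ := hB'.1 i
      exact (hA _ (f' j) (by rwa [hef'])).1
  have hf : Set.range f = Set.range f' := by
    apply Set.Subset.antisymm
    · rintro _ ⟨j, rfl⟩
      obtain ⟨i, hi⟩ := hB.2 j
      exact (hA' (e i) _ (by rwa [hef])).2
    · rintro _ ⟨j, rfl⟩
      obtain ⟨i, hi⟩ := hB'.2 j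
      exact (hA (e' i) _ (by rwa [hef'])).2
  obtain ⟨σ, hσ⟩ := exists_equiv_comp_eq he
  obtain ⟨τ, hτ⟩ := exists_equiv_comp_eq hf
  exact ⟨σ, τ, fun i j => by rw [← hef', hσ, hτ, hef]⟩

theorem exists_perm_comp_eq {n k : ℕ} (e e' : Fin k ↪ Fin n) :
    ∃ σ : Equiv.Perm (Fin n), ∀ i, σ (e i) = e' i := by
  obtain ⟨σ, hσ⟩ := (Equiv.Perm.isMultiplyPretransitive (Fin n) k).exists_smul_eq e e'
  exact ⟨σ, fun i => by simpa using congrArg (fun g : Fin k ↪ Fin n => g i) hσ⟩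

theorem IsCore.mem_orbit {n m k p q : ℕ} [NeZero q] {A A' : Fin n → Fin m → Fin q}
    {B : Fin k → Fin p → Fin q} (h : IsCore A B) (h' : IsCore A' B) :
    A ∈ MulAction.orbit (Equiv.Perm (Fin n) × Equiv.Perm (Fin m)) A' := by
  obtain ⟨e, f, hef, hA⟩ := h
  obtain ⟨e', f', hef', hA'⟩ := h'
  obtain ⟨σ, hσ⟩ := exists_perm_comp_eq e e'
  obtain ⟨τ, hτ⟩ := exists_perm_comp_eq f f'
  refine ⟨(σ⁻¹, τ⁻¹), ?_⟩
  funext i j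
  change A' (σ⁻¹⁻¹ i) (τ⁻¹⁻¹ j) = A i j
  rw [inv_inv, inv_inv]
  by_cases hij : i ∈ Set.range e ∧ j ∈ Set.range f
  · obtain ⟨⟨i, rfl⟩, ⟨j, rfl⟩⟩ := hij
    rw [hσ, hτ, hef, hef']
  · rw [not_not.1 fun h0 => hij (hA i j h0)]
    refine not_not.1 fun h0 => hij ?_
    obtain ⟨⟨a, ha⟩, ⟨b, hb⟩⟩ := hA' _ _ h0
    exact ⟨⟨a, σ.injective (by rw [hσ, ha])⟩, ⟨b, τ.injective (by rw [hτ, hb])⟩⟩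

theorem IsCore.smul {n m k p q : ℕ} [NeZero q] {A : Fin n → Fin m → Fin q}
    {B : Fin k → Fin p → Fin q} (h : IsCore A B)
    (g : Equiv.Perm (Fin k) × Equiv.Perm (Fin p)) : IsCore A (g • B) := by
  obtain ⟨e, f, hef, hA⟩ := h
  refine ⟨g.1⁻¹.toEmbedding.trans e, g.2⁻¹.toEmbedding.trans f, fun i j => hef _ _,
    fun i j hij => ?_⟩
  obtain ⟨⟨a, rfl⟩, ⟨b, rfl⟩⟩ := hA i j hij
  exact ⟨⟨g.1 a, by simp⟩, ⟨g.2 b, by simp⟩⟩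

theorem IsCore.of_smul {n m k p q : ℕ} [NeZero q] {A : Fin n → Fin m → Fin q}
    {B : Fin k → Fin p → Fin q} (h : IsCore A B)
    (g : Equiv.Perm (Fin n) × Equiv.Perm (Fin m)) : IsCore (g • A) B := by
  obtain ⟨e, f, hef, hA⟩ := h
  refine ⟨e.trans g.1.toEmbedding, f.trans g.2.toEmbedding, fun i j => ?_, fun i j hij => ?_⟩
  · change A (g.1⁻¹ (g.1 (e i))) (g.2⁻¹ (g.2 (f j))) = B i j
    simpa using hef i j
  · obtain ⟨⟨a, ha⟩, ⟨b, hb⟩⟩ := hA _ _ hij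
    exact ⟨⟨a, by simp [ha]⟩, ⟨b, by simp [hb]⟩⟩

theorem sum_matType {n m q : ℕ} (A : Fin n → Fin m → Fin q) : ∑ v, matType A v = n * m := by
  have h := Finset.card_eq_sum_card_fiberwise (s := (Finset.univ : Finset (Fin n × Fin m)))
    (t := Finset.univ) (f := fun ij => A ij.1 ij.2) (fun _ _ => by simp)
  simpa [matType] using h.symm

theorem IsCore.matType_eq {n m k p q : ℕ} [NeZero q] {A : Fin n → Fin m → Fin q}
    {B : Fin k → Fin p → Fin q} (h : IsCore A B) {v : Fin q} (hv : v ≠ 0) :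
    matType A v = matType B v := by
  obtain ⟨e, f, hef, hA⟩ := h
  unfold matType
  rw [← Finset.card_map (e.prodMap f)]
  congr 1
  ext ⟨i, j⟩
  simp only [Finset.mem_filter, Finset.mem_univ, true_and, Finset.mem_map, Prod.exists]
  constructor
  · rintro rfl
    obtain ⟨⟨a, rfl⟩, ⟨b, rfl⟩⟩ := hA i j hv
    exact ⟨a, b, (hef a b).symm, rfl⟩
  · rintro ⟨a, b, hab, h⟩
    obtain ⟨rfl, rfl⟩ := Prod.mk.inj h
    exact (hef a b).trans hab

theorem IsCore.matType_zero_add {n m k p q : ℕ} [NeZero q] {A : Fin n → Fin m → Fin q}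
    {B : Fin k → Fin p → Fin q} (h : IsCore A B) :
    matType A 0 + k * p = matType B 0 + n * m := by
  rw [← sum_matType A, ← sum_matType B, ← Finset.add_sum_erase _ _ (Finset.mem_univ 0),
    ← Finset.add_sum_erase _ (matType A) (Finset.mem_univ 0),
    Finset.sum_congr rfl fun v hv => h.matType_eq (Finset.ne_of_mem_erase hv)]
  omega

theorem IsCore.matType_eq_iff {n m k p q : ℕ} [NeZero q] {A : Fin n → Fin m → Fin q}
    {B : Fin k → Fin p → Fin q} (h : IsCore A B) (hk : k ≤ n) (hp : p ≤ m) (t : Fin q → ℕ) :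
    matType A = t ↔
      (∀ v, v ≠ 0 → matType B v = t v) ∧ matType B 0 + (n * m - k * p) = t 0 := by
  have h0 := h.matType_zero_add
  have hle : k * p ≤ n * m := Nat.mul_le_mul hk hp
  constructor
  · rintro rfl
    exact ⟨fun v hv => (h.matType_eq hv).symm, by omega⟩
  · rintro ⟨h1, h2⟩
    funext v
    by_cases hv : v = 0
    · subst hv
      omega
    · rw [h.matType_eq hv, h1 v hv]

theorem IsCore.pos {n m k p q : ℕ} [NeZero q] {A : Fin n → Fin m → Fin q}
    {B : Fin k → Fin p → Fin q} (h : IsCore A B) (hA : matType A 0 < n * m) :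
    1 ≤ k ∧ 1 ≤ p := by
  have h0 := h.matType_zero_add
  have hkp : 0 < k * p := by omega
  exact ⟨Nat.pos_of_mul_pos_right hkp, Nat.pos_of_mul_pos_left hkp⟩

/-- Type-refined decomposition of weighted bipartite graphs into their packed core:
for a type `t` with `Σ_v t(v) = n·m` and `t(0) < n·m`, the number of orbits of matrices
of type `t` equals the sum over `1 ≤ k ≤ n`, `1 ≤ p ≤ m` of the numbers of orbits of
packed matrices whose type `t'` agrees with `t` away from `0` and satisfies
`t'(0) = t(0) − (n·m − k·p)` (no such orbit exists when `t(0) < n·m − k·p`). -/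
theorem card_orbits_of_type_eq_sum_card_packed_orbits (q : ℕ) [NeZero q] (n m : ℕ)
    (t : Fin q → ℕ) (ht_sum : ∑ v, t v = n * m) (ht0 : t 0 < n * m) :
    Nat.card {ω : MulAction.orbitRel.Quotient (Equiv.Perm (Fin n) × Equiv.Perm (Fin m))
        (Fin n → Fin m → Fin q) // ∃ A ∈ ω.orbit, matType A = t}
      = ∑ k ∈ Finset.Icc 1 n, ∑ p ∈ Finset.Icc 1 m,
          Nat.card {ω : MulAction.orbitRel.Quotient
              (Equiv.Perm (Fin k) × Equiv.Perm (Fin p))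
              {B : Fin k → Fin p → Fin q // Packed B} //
            ∃ B ∈ ω.orbit, (∀ v, v ≠ 0 → matType B.val v = t v) ∧
              matType B.val 0 + (n * m - k * p) = t 0} := by
  rw [← Finset.sum_product', ← Finset.sum_coe_sort, ← Nat.card_sigma]
  symm
  have key : ∀ x : (Σ i : ↥(Finset.Icc 1 n ×ˢ Finset.Icc 1 m),
      {ω : MulAction.orbitRel.Quotient
          (Equiv.Perm (Fin i.1.1) × Equiv.Perm (Fin i.1.2))
          {B : Fin i.1.1 → Fin i.1.2 → Fin q // Packed B} //
        ∃ B ∈ ω.orbit, (∀ v, v ≠ 0 → matType B.val v = t v) ∧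
          matType B.val 0 + (n * m - i.1.1 * i.1.2) = t 0}),
      ∃ ω : {ω : MulAction.orbitRel.Quotient (Equiv.Perm (Fin n) × Equiv.Perm (Fin m))
        (Fin n → Fin m → Fin q) // ∃ A ∈ ω.orbit, matType A = t},
      ∃ A ∈ ω.1.orbit, ∃ B ∈ x.2.1.orbit, IsCore A B.1 := by
    rintro ⟨⟨⟨k, p⟩, hkp⟩, ω, B, hB, hBt⟩
    simp only [Finset.mem_product, Finset.mem_Icc] at hkp
    obtain ⟨A, hA⟩ := exists_isCore_of_le hkp.1.2 hkp.2.2 B.1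
    let ω' : MulAction.orbitRel.Quotient (Equiv.Perm (Fin n) × Equiv.Perm (Fin m))
        (Fin n → Fin m → Fin q) := Quotient.mk'' A
    have hm : A ∈ ω'.orbit := MulAction.orbitRel.Quotient.mem_orbit.2 rfl
    exact ⟨⟨ω', A, hm, (hA.matType_eq_iff hkp.1.2 hkp.2.2 t).2 hBt⟩,
      A, hm, B, hB, hA⟩
  choose F hF using key
  refine Nat.card_eq_of_bijective F ⟨fun x y hxy => ?_, fun ω => ?_⟩
  · obtain ⟨A, hA, B, hB, hAB⟩ := hF x
    obtain ⟨A', hA', B', hB', hAB'⟩ := hF y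
    rw [← hxy] at hA'
    rw [MulAction.orbitRel.Quotient.mem_orbit] at hA hA' hB hB'
    obtain ⟨g, rfl⟩ := MulAction.orbitRel_apply.1 (Quotient.eq''.1 (hA'.trans hA.symm))
    obtain ⟨σ, τ, h⟩ := (hAB.of_smul g).exists_equiv hAB' B.2 B'.2
    obtain ⟨⟨⟨k, p⟩, hkp⟩, ω, hω⟩ := x
    obtain ⟨⟨⟨k', p'⟩, hkp'⟩, ω', hω'⟩ := y
    obtain rfl : k = k' := by simpa using Fintype.card_congr σ
    obtain rfl : p = p' := by simpa using Fintype.card_congr τ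
    obtain rfl : ω = ω' := by
      refine hB.symm.trans (Eq.trans (Quotient.eq''.2 (MulAction.orbitRel_apply.2 ?_)) hB')
      refine ⟨(σ⁻¹, τ⁻¹), Subtype.ext ?_⟩
      funext i j
      change B'.1 (σ⁻¹⁻¹ i) (τ⁻¹⁻¹ j) = B.1 i j
      rw [inv_inv, inv_inv]
      exact h i j
    rfl
  · obtain ⟨ω, A, hA, hAt⟩ := ω
    obtain ⟨k, p, B, hk, hp, hB, hAB⟩ := exists_packed_isCore A
    obtain ⟨hk1, hp1⟩ := hAB.pos (by rwa [hAt])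
    let x : (Σ i : ↥(Finset.Icc 1 n ×ˢ Finset.Icc 1 m),
        {ω : MulAction.orbitRel.Quotient
            (Equiv.Perm (Fin i.1.1) × Equiv.Perm (Fin i.1.2))
            {B : Fin i.1.1 → Fin i.1.2 → Fin q // Packed B} //
          ∃ B ∈ ω.orbit, (∀ v, v ≠ 0 → matType B.val v = t v) ∧
            matType B.val 0 + (n * m - i.1.1 * i.1.2) = t 0}) :=
      ⟨⟨(k, p), by simp [hk1, hp1, hk, hp]⟩, Quotient.mk'' ⟨B, hB⟩, ⟨B, hB⟩,
        MulAction.orbitRel.Quotient.mem_orbit.2 rfl, (hAB.matType_eq_iff hk hp t).1 hAt⟩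
    refine ⟨x, Subtype.ext ?_⟩
    obtain ⟨A', hA', B', hB', hAB'⟩ := hF x
    rw [MulAction.orbitRel.Quotient.mem_orbit] at hA hA' hB'
    obtain ⟨g, rfl⟩ := MulAction.orbitRel_apply.1 (Quotient.eq''.1 hB')
    exact hA'.symm.trans (Eq.trans (Quotient.eq''.2 (MulAction.orbitRel_apply.2
      (hAB'.mem_orbit (hAB.smul g)))) hA)
end

section
/- Unique factorization into connected permutations: for every n ≥ 1 and every σ ∈ Perm (Fin n), there exist a unique r ≥ 1, a unique sequence of positive integers (n₁, …, n_r) with n₁ + ⋯ + n_r = n, and unique connected permutations σ_i ∈ Perm (Fin n_i) for 1 ≤ i ≤ r, such that σ = σ₁ →⁺ σ₂ →⁺ ⋯ →⁺ σ_r (the iterated intransitive product, transported along the canonical equivalence identifying Fin (n₁ + ⋯ + n_r) with Fin n). -/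
/-- The intransitive product `σ →⁺ τ` of two permutations: the conjugate of
`Equiv.sumCongr σ τ` by the canonical equivalence `finSumFinEquiv`
(shifted concatenation of the permutation words). -/
def intransitive {n m : ℕ} (σ : Equiv.Perm (Fin n)) (τ : Equiv.Perm (Fin m)) :
    Equiv.Perm (Fin (n + m)) :=
  Equiv.permCongr finSumFinEquiv (Equiv.sumCongr σ τ)

/-- A permutation `σ ∈ Perm (Fin n)` is connected if there is no `k` with `0 < k < n`
such that `σ` maps the initial segment `{i | i.val < k}` onto itself. -/
def ConnectedPerm {n : ℕ} (σ : Equiv.Perm (Fin n)) : Prop :=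
  ∀ k, 0 < k → k < n → ¬ (∀ i : Fin n, i.val < k → (σ i).val < k)

/-- The total size `n₁ + ⋯ + n_r` of a list of permutations `σ_i ∈ Perm (Fin n_i)`. -/
def sumLens : List (Σ k : ℕ, Equiv.Perm (Fin k)) → ℕ
  | [] => 0
  | a :: l => a.1 + sumLens l

/-- The iterated intransitive product `σ₁ →⁺ σ₂ →⁺ ⋯ →⁺ σ_r` of a list of
permutations. -/
def iterIntransitive :
    (l : List (Σ k : ℕ, Equiv.Perm (Fin k))) → Equiv.Perm (Fin (sumLens l))
  | [] => 1
  | a :: l => intransitive a.2 (iterIntransitive l)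

theorem intransitive_castAdd {n m : ℕ} (σ : Equiv.Perm (Fin n)) (τ : Equiv.Perm (Fin m))
    (i : Fin n) : intransitive σ τ (Fin.castAdd m i) = Fin.castAdd m (σ i) := by
  simp [intransitive, Equiv.permCongr_apply]

theorem intransitive_natAdd {n m : ℕ} (σ : Equiv.Perm (Fin n)) (τ : Equiv.Perm (Fin m))
    (i : Fin m) : intransitive σ τ (Fin.natAdd n i) = Fin.natAdd n (τ i) := by
  simp [intransitive, Equiv.permCongr_apply]

theorem intransitive_injective {n m : ℕ} {σ σ' : Equiv.Perm (Fin n)} {τ τ' : Equiv.Perm (Fin m)}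
    (h : intransitive σ τ = intransitive σ' τ') : σ = σ' ∧ τ = τ' := by
  constructor
  · ext i
    have := congrArg Fin.val (Equiv.congr_fun h (Fin.castAdd m i))
    simpa [intransitive_castAdd] using this
  · ext i
    have := congrArg Fin.val (Equiv.congr_fun h (Fin.natAdd n i))
    simpa [intransitive_natAdd] using this

/-- A permutation preserving the initial segment of length `k` is an intransitive product. -/
theorem exists_eq_intransitive {k m : ℕ} (σ : Equiv.Perm (Fin (k + m)))
    (h : ∀ i, i.val < k → (σ i).val < k) : ∃ α β, σ = intransitive α β := by
  have hmem : finSumFinEquiv.symm.permCongr σ ∈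
      (Equiv.Perm.sumCongrHom (Fin k) (Fin m)).range := by
    apply Equiv.Perm.mem_sumCongrHom_range_of_perm_mapsTo_inl
    rintro _ ⟨i, rfl⟩
    refine ⟨⟨σ (Fin.castAdd m i), h _ (by simp)⟩, ?_⟩
    rw [Equiv.permCongr_apply, Equiv.eq_symm_apply]
    ext
    simp
  obtain ⟨⟨α, β⟩, hαβ⟩ := hmem
  refine ⟨α, β, ?_⟩
  have : σ = finSumFinEquiv.permCongr (finSumFinEquiv.symm.permCongr σ) := by
    ext i
    simp [Equiv.permCongr_apply]
  rw [this, ← hαβ]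
  rfl

theorem intransitive_val_lt {n m : ℕ} (σ : Equiv.Perm (Fin n)) (τ : Equiv.Perm (Fin m))
    (i : Fin (n + m)) (hi : i.val < n) : (intransitive σ τ i).val < n := by
  obtain ⟨j, rfl⟩ : ∃ j : Fin n, i = Fin.castAdd m j := ⟨⟨i, hi⟩, rfl⟩
  simp [intransitive_castAdd]

/-- A connected permutation admits no intransitive factorization with a shorter first factor. -/
theorem ConnectedPerm.le_of_sigma_eq {n m n' m' : ℕ} {σ : Equiv.Perm (Fin n)}
    {τ : Equiv.Perm (Fin m)} {σ' : Equiv.Perm (Fin n')} {τ' : Equiv.Perm (Fin m')}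
    (hσ : ConnectedPerm σ) (hn' : 0 < n')
    (h : (⟨n + m, intransitive σ τ⟩ : Σ k : ℕ, Equiv.Perm (Fin k)) =
      ⟨n' + m', intransitive σ' τ'⟩) : n ≤ n' := by
  by_contra! hlt
  have key : ∀ s : Σ k : ℕ, Equiv.Perm (Fin k), s = ⟨n' + m', intransitive σ' τ'⟩ →
      ∀ i, i.val < n' → (s.2 i).val < n' := by
    rintro _ rfl
    exact intransitive_val_lt σ' τ'
  refine hσ n' hn' hlt fun i hi => ?_
  simpa [intransitive_castAdd] using key _ h (Fin.castAdd m i) hi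

theorem eq_of_iterIntransitive_sigma_eq (l l' : List (Σ k : ℕ, Equiv.Perm (Fin k)))
    (hl : ∀ a ∈ l, 0 < a.1 ∧ ConnectedPerm a.2) (hl' : ∀ a ∈ l', 0 < a.1 ∧ ConnectedPerm a.2)
    (h : (⟨sumLens l, iterIntransitive l⟩ : Σ k : ℕ, Equiv.Perm (Fin k)) =
      ⟨sumLens l', iterIntransitive l'⟩) : l = l' := by
  induction l generalizing l' with
  | nil =>
    cases l' with
    | nil => rfl
    | cons b l' =>
      have h0 : 0 = b.1 + sumLens l' := congrArg Sigma.fst h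
      have := (hl' b (by simp)).1
      omega
  | cons a l ih =>
    cases l' with
    | nil =>
      have h0 : a.1 + sumLens l = 0 := congrArg Sigma.fst h
      have := (hl a (by simp)).1
      omega
    | cons b l' =>
      obtain ⟨ha, hac⟩ := hl a (by simp)
      obtain ⟨hb, hbc⟩ := hl' b (by simp)
      have hab : a.1 = b.1 := le_antisymm (hac.le_of_sigma_eq hb h) (hbc.le_of_sigma_eq ha h.symm)
      have hsum : a.1 + sumLens l = b.1 + sumLens l' := congrArg Sigma.fst h
      have hrest : sumLens l = sumLens l' := by omega
      specialize ih l' (fun c hc => hl c (by simp [hc])) (fun c hc => hl' c (by simp [hc]))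
      obtain ⟨k, α⟩ := a
      obtain ⟨k', α'⟩ := b
      obtain rfl : k = k' := hab
      simp only [sumLens, iterIntransitive] at h
      generalize iterIntransitive l = τ, iterIntransitive l' = τ' at h ih
      generalize sumLens l = m at *
      subst hrest
      obtain ⟨rfl, rfl⟩ := intransitive_injective (eq_of_heq (Sigma.mk.inj h).2)
      rw [ih rfl]

theorem exists_connected_factorization (n : ℕ) (σ : Equiv.Perm (Fin n)) :
    ∃ l : List (Σ k : ℕ, Equiv.Perm (Fin k)), (∀ a ∈ l, 0 < a.1 ∧ ConnectedPerm a.2) ∧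
      (⟨sumLens l, iterIntransitive l⟩ : Σ k : ℕ, Equiv.Perm (Fin k)) = ⟨n, σ⟩ := by
  classical
  induction n using Nat.strong_induction_on with
  | _ n ih =>
    rcases Nat.eq_zero_or_pos n with rfl | hn
    · exact ⟨[], by simp, congrArg (Sigma.mk 0) (Subsingleton.elim _ _)⟩
    have hex : ∃ k, 0 < k ∧ k ≤ n ∧ ∀ i : Fin n, i.val < k → (σ i).val < k :=
      ⟨n, hn, le_rfl, fun i _ => (σ i).isLt⟩
    obtain ⟨hk, hkn, hinv⟩ := Nat.find_spec hex
    have hmin := fun j => Nat.find_min (m := j) hex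
    generalize Nat.find hex = k at *
    obtain ⟨m, rfl⟩ := Nat.exists_eq_add_of_le hkn
    obtain ⟨α, β, rfl⟩ := exists_eq_intransitive σ hinv
    obtain ⟨l, hl, hlβ⟩ := ih m (by omega) β
    refine ⟨⟨k, α⟩ :: l, ?_, ?_⟩
    · rintro a (_ | ⟨_, ha⟩)
      · refine ⟨hk, fun j hj (hjk : j < k) hα => hmin j hjk ⟨hj, by omega, fun i hi => ?_⟩⟩
        obtain ⟨i, rfl⟩ : ∃ i' : Fin k, i = Fin.castAdd m i' := ⟨⟨i, hi.trans hjk⟩, rfl⟩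
        simpa [intransitive_castAdd] using hα i hi
      · exact hl a ha
    · exact congrArg (fun s : Σ k : ℕ, Equiv.Perm (Fin k) =>
        (⟨k + s.1, intransitive α s.2⟩ : Σ k : ℕ, Equiv.Perm (Fin k))) hlβ

theorem permCongr_finCongr_eq_iff {m n : ℕ} (τ : Equiv.Perm (Fin m)) (σ : Equiv.Perm (Fin n)) :
    (∃ h : m = n, Equiv.permCongr (finCongr h) τ = σ) ↔
      (⟨m, τ⟩ : Σ k : ℕ, Equiv.Perm (Fin k)) = ⟨n, σ⟩ := by
  constructor
  · rintro ⟨rfl, rfl⟩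
    rfl
  · intro h
    cases h
    exact ⟨rfl, rfl⟩

/-- Unique factorization into connected permutations: every `σ ∈ Perm (Fin n)` with
`n ≥ 1` is in a unique way the iterated intransitive product of a (unique, nonempty)
list of connected permutations `σ_i ∈ Perm (Fin n_i)` with `n_i ≥ 1` and
`n₁ + ⋯ + n_r = n`, transported along the canonical equivalence
`Fin (n₁ + ⋯ + n_r) ≃ Fin n`. -/
theorem existsUnique_connected_factorization (n : ℕ) (hn : 1 ≤ n) (σ : Equiv.Perm (Fin n)) :
    ∃! l : List (Σ k : ℕ, Equiv.Perm (Fin k)),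
      l ≠ [] ∧ (∀ a ∈ l, 0 < a.1 ∧ ConnectedPerm a.2) ∧
      ∃ h : sumLens l = n, Equiv.permCongr (finCongr h) (iterIntransitive l) = σ := by
  simp only [permCongr_finCongr_eq_iff]
  obtain ⟨l, hl, h⟩ := exists_connected_factorization n σ
  refine ⟨l, ⟨?_, hl, h⟩, fun l' ⟨_, hl', h'⟩ =>
    eq_of_iterIntransitive_sigma_eq l' l hl' hl (h'.trans h.symm)⟩
  rintro rfl
  have : 0 = n := congrArg Sigma.fst h
  omega
end
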